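/- Dimensional crossover, part (iii) (Theorem 1.2(iii)): for p = 6, no ground state of mass μ on the grid 𝒢 exists for any μ > 0; moreover, E_6(u) ≥ 0 for every u ∈ H¹_μ(𝒢) when μ ≤ μ_6 (so ℰ_6(μ) = 0 and is not attained), while E_6 is unbounded from below on H¹_μ(𝒢) when μ > μ_6. -/

import Mathlib

/- Formalization of NLS ground states on the two-dimensional grid 𝒢
   (the planar metric graph with vertex set ℤ×ℤ and unit edges).

   A function `u` on 𝒢 is encoded by the family `h j` of its restrictions to
   the horizontal lines `H j` and the family `w k` of its restrictions to the
   vertical lines `V k`, subject to the vertex-compatibility conditions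
   `h j k = w k j`.  The (weak) derivative of `u` along each line is carried
   as additional data `hd`, `wd`, tied to `h`, `w` by the fundamental theorem
   of calculus in the membership predicates below. -/

open MeasureTheory Filter Topology
open scoped ENNReal NNReal

noncomputable section

/-- A function on the grid 𝒢, together with candidate derivatives along
horizontal and vertical lines. -/
structure GridFunc where
  /-- restriction to the horizontal line `H j` -/
  h : ℤ → ℝ → ℝ
  /-- restriction to the vertical line `V k` -/
  w : ℤ → ℝ → ℝ
  /-- derivative along the horizontal line `H j` -/
  hd : ℤ → ℝ → ℝ
  /-- derivative along the vertical line `V k` -/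
  wd : ℤ → ℝ → ℝ
  /-- vertex compatibility: the values at the vertex `(k, j)` agree -/
  compat : ∀ j k : ℤ, h j (k : ℝ) = w k (j : ℝ)

/-- `∑_j ∫_ℝ |f j|^p + ∑_k ∫_ℝ |g k|^p`, as an extended nonnegative real:
the `p`-th power of the `L^p(𝒢)` norm of the function encoded by `(f, g)`. -/
def gridLpPow (p : ℝ) (f g : ℤ → ℝ → ℝ) : ℝ≥0∞ :=
  (∑' j : ℤ, ∫⁻ x : ℝ, (‖f j x‖₊ : ℝ≥0∞) ^ p) +
  (∑' k : ℤ, ∫⁻ y : ℝ, (‖g k y‖₊ : ℝ≥0∞) ^ p)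

/-- The `L^p(𝒢)` norm of `u`. -/
def GridFunc.lpNorm (u : GridFunc) (p : ℝ) : ℝ≥0∞ :=
  gridLpPow p u.h u.w ^ (1 / p)

/-- The `L^p(𝒢)` norm of the derivative `u'`. -/
def GridFunc.derivLpNorm (u : GridFunc) (p : ℝ) : ℝ≥0∞ :=
  gridLpPow p u.hd u.wd ^ (1 / p)

/-- The `L^∞(𝒢)` norm of `u`: the sup over all lines of the sup norms. -/
def GridFunc.linfNorm (u : GridFunc) : ℝ≥0∞ :=
  (⨆ j : ℤ, ⨆ x : ℝ, (‖u.h j x‖₊ : ℝ≥0∞)) ⊔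
  (⨆ k : ℤ, ⨆ y : ℝ, (‖u.w k y‖₊ : ℝ≥0∞))

/-- `u ∈ H¹(𝒢)`: every line restriction is continuous and is recovered from
its (locally integrable) derivative by integration, and both `‖u‖₂²` and
`‖u'‖₂²` are finite. -/
def GridFunc.MemH1 (u : GridFunc) : Prop :=
  (∀ j, Continuous (u.h j)) ∧ (∀ k, Continuous (u.w k)) ∧
  (∀ j, LocallyIntegrable (u.hd j)) ∧ (∀ k, LocallyIntegrable (u.wd k)) ∧
  (∀ j x, (∫ t in (0:ℝ)..x, u.hd j t) = u.h j x - u.h j 0) ∧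
  (∀ k y, (∫ t in (0:ℝ)..y, u.wd k t) = u.w k y - u.w k 0) ∧
  gridLpPow 2 u.h u.w < ⊤ ∧ gridLpPow 2 u.hd u.wd < ⊤

/-- `u ∈ W^{1,1}(𝒢)`: every line restriction is continuous and is recovered
from its (integrable) derivative by integration, and both `‖u‖₁` and `‖u'‖₁`
are finite. -/
def GridFunc.MemW11 (u : GridFunc) : Prop :=
  (∀ j, Continuous (u.h j)) ∧ (∀ k, Continuous (u.w k)) ∧
  (∀ j, Integrable (u.hd j)) ∧ (∀ k, Integrable (u.wd k)) ∧
  (∀ j x, (∫ t in (0:ℝ)..x, u.hd j t) = u.h j x - u.h j 0) ∧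
  (∀ k y, (∫ t in (0:ℝ)..y, u.wd k t) = u.w k y - u.w k 0) ∧
  gridLpPow 1 u.h u.w < ⊤ ∧ gridLpPow 1 u.hd u.wd < ⊤

/-- The mass `‖u‖_{L²(𝒢)}²` of `u`, as a real number. -/
def GridFunc.mass (u : GridFunc) : ℝ :=
  (gridLpPow 2 u.h u.w).toReal

/-- The NLS energy `E_p(u) = ½‖u'‖₂² − (1/p)‖u‖_p^p`. -/
def GridFunc.energy (u : GridFunc) (p : ℝ) : ℝ :=
  (1 / 2) * (gridLpPow 2 u.hd u.wd).toReal
    - (1 / p) * (gridLpPow p u.h u.w).toReal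

/-- `u` is not identically zero on 𝒢. -/
def GridFunc.Nonzero (u : GridFunc) : Prop :=
  (∃ j x, u.h j x ≠ 0) ∨ (∃ k y, u.w k y ≠ 0)

/-- The Gagliardo–Nirenberg quotient
`Q_p(u) = ‖u‖_p^p / (‖u‖₂^{p−2} ‖u'‖₂²)`. -/
def GridFunc.gnQuot (u : GridFunc) (p : ℝ) : ℝ :=
  (gridLpPow p u.h u.w).toReal /
    ((gridLpPow 2 u.h u.w).toReal ^ ((p - 2) / 2) *
      (gridLpPow 2 u.hd u.wd).toReal)

/-- The set of Gagliardo–Nirenberg quotients `Q_p(u)` over nontrivial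
`u ∈ H¹(𝒢)`; its supremum is the optimal constant `K_p`. -/
def gnSet (p : ℝ) : Set ℝ :=
  {q | ∃ u : GridFunc, u.MemH1 ∧ u.Nonzero ∧ q = u.gnQuot p}

/-- The critical mass `μ_p = (p/(2K))^{2/(p−2)}` associated with the optimal
Gagliardo–Nirenberg constant `K`. -/
def critMass (p K : ℝ) : ℝ :=
  (p / (2 * K)) ^ (2 / (p - 2))

/-- The `H¹(𝒢)` inner product `⟨u,v⟩_{L²(𝒢)} + ⟨u',v'⟩_{L²(𝒢)}`. -/
def GridFunc.h1Inner (u v : GridFunc) : ℝ :=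
  ((∑' j : ℤ, ∫ x : ℝ, u.h j x * v.h j x) +
    (∑' k : ℤ, ∫ y : ℝ, u.w k y * v.w k y)) +
  ((∑' j : ℤ, ∫ x : ℝ, u.hd j x * v.hd j x) +
    (∑' k : ℤ, ∫ y : ℝ, u.wd k y * v.wd k y))

/-- The set of energies `E_p(u)` of functions `u ∈ H¹_μ(𝒢)`; its infimum is
the ground-state energy level `ℰ_p(μ)`. -/
def energySet (p μ : ℝ) : Set ℝ :=
  {e | ∃ u : GridFunc, u.MemH1 ∧ u.mass = μ ∧ u.energy p = e}

/-- `u` is a ground state of mass `μ`: it belongs to `H¹_μ(𝒢)` and minimizes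
the energy `E_p` there. -/
def IsGroundState (p μ : ℝ) (u : GridFunc) : Prop :=
  u.MemH1 ∧ u.mass = μ ∧
    ∀ v : GridFunc, v.MemH1 → v.mass = μ → u.energy p ≤ v.energy p

end

noncomputable section

/-- the `p`-th power of the `L^p` norm on a set -/
def lineP (p : ℝ) (f : ℝ → ℝ) (S : Set ℝ) : ℝ≥0∞ := ∫⁻ x in S, (‖f x‖₊ : ℝ≥0∞) ^ p

/-- `g` is a locally integrable weak derivative of `f` -/
def IsPrim (f g : ℝ → ℝ) : Prop :=
  Continuous f ∧ LocallyIntegrable g ∧ ∀ a b : ℝ, (∫ t in a..b, g t) = f b - f a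

/-- `f ∈ H¹(ℝ)` with derivative `g` -/
def LineH1 (f g : ℝ → ℝ) : Prop :=
  IsPrim f g ∧ lineP 2 f Set.univ < ⊤ ∧ lineP 2 g Set.univ < ⊤

lemma lineP_mono {p : ℝ} {f : ℝ → ℝ} {S T : Set ℝ} (h : S ⊆ T) : lineP p f S ≤ lineP p f T :=
  lintegral_mono_set h

lemma lineP_congr {p : ℝ} {f f' : ℝ → ℝ} {S : Set ℝ} (hS : MeasurableSet S)
    (h : ∀ x ∈ S, f x = f' x) : lineP p f S = lineP p f' S :=
  setLIntegral_congr_fun hS (fun x hx => by simp only [h x hx])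

lemma lineP_split (p : ℝ) (f : ℝ → ℝ) (a : ℝ) :
    lineP p f Set.univ = lineP p f (Set.Iic a) + lineP p f (Set.Ioi a) := by
  unfold lineP
  rw [← Set.compl_Iic, Measure.restrict_univ, lintegral_add_compl _ measurableSet_Iic]

lemma lineP_split' (p : ℝ) (f : ℝ → ℝ) {a b : ℝ} (hab : a ≤ b) :
    lineP p f (Set.Iic b) = lineP p f (Set.Iic a) + lineP p f (Set.Ioc a b) := by
  unfold lineP
  rw [← lintegral_union measurableSet_Ioc, Set.Iic_union_Ioc_eq_Iic hab]
  rw [Set.disjoint_left]; intro x hx hx'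
  exact absurd hx'.1 (not_lt.2 hx)

lemma lineP_Iio_eq (p : ℝ) (f : ℝ → ℝ) (a : ℝ) :
    lineP p f (Set.Iio a) = lineP p f (Set.Iic a) :=
  setLIntegral_congr Iio_ae_eq_Iic

lemma lineP_eq_zero_of {p : ℝ} (hp : 0 < p) {f : ℝ → ℝ} {S : Set ℝ} (hS : MeasurableSet S)
    (h : ∀ x ∈ S, f x = 0) : lineP p f S = 0 := by
  rw [lineP_congr (f' := fun _ => 0) hS h]; simp [lineP, hp]

lemma lineP_le_of {p : ℝ} (hp : 0 < p) {f : ℝ → ℝ} {S : Set ℝ} (hS : MeasurableSet S) {M : ℝ}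
    (h : ∀ x ∈ S, |f x| ≤ M) : lineP p f S ≤ ENNReal.ofReal M ^ p * volume S := by
  unfold lineP
  calc _ ≤ ∫⁻ x in S, ENNReal.ofReal M ^ p := by
        refine setLIntegral_mono' hS fun x hx => ?_
        gcongr
        rw [← enorm_eq_nnnorm, Real.enorm_eq_ofReal_abs]
        exact ENNReal.ofReal_le_ofReal (h x hx)
    _ = _ := by simp

lemma li_of_ii {g : ℝ → ℝ} (h : ∀ a b : ℝ, IntervalIntegrable g volume a b) :
    LocallyIntegrable g := fun x =>
  ⟨Set.Ioc (x - 1) (x + 1), Ioc_mem_nhds (by linarith) (by linarith), (h _ _).1⟩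

lemma ii_of_li {g : ℝ → ℝ} (h : LocallyIntegrable g) (a b : ℝ) :
    IntervalIntegrable g volume a b :=
  (h.integrableOn_isCompact isCompact_uIcc).intervalIntegrable

lemma IsPrim.ii {f g : ℝ → ℝ} (h : IsPrim f g) (a b : ℝ) : IntervalIntegrable g volume a b :=
  ii_of_li h.2.1 a b

lemma IsPrim.glue {f₁ g₁ f₂ g₂ : ℝ → ℝ} (h₁ : IsPrim f₁ g₁) (h₂ : IsPrim f₂ g₂) {a : ℝ}
    (ha : f₁ a = f₂ a) :
    IsPrim (fun x => if x ≤ a then f₁ x else f₂ x) (fun x => if x ≤ a then g₁ x else g₂ x) := by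
  have hli : LocallyIntegrable (fun x => if x ≤ a then g₁ x else g₂ x) := by
    have := (h₁.2.1.indicator (s := Set.Iic a) measurableSet_Iic).add
      (h₂.2.1.indicator (s := Set.Ioi a) measurableSet_Ioi)
    refine this.congr (Filter.Eventually.of_forall fun x => ?_)
    by_cases hx : x ≤ a <;> simp [Set.indicator, hx, not_lt.2, not_le.1]
  have key : ∀ d : ℝ, (∫ t in a..d, (if t ≤ a then g₁ t else g₂ t)) =
      (if d ≤ a then f₁ d else f₂ d) - f₁ a := by
    intro d
    by_cases hd : d ≤ a
    · rw [if_pos hd, ← h₁.2.2]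
      refine intervalIntegral.integral_congr_uIoo fun x hx => ?_
      rw [Set.uIoo_of_ge hd] at hx
      simp [hx.2.le]
    · rw [if_neg hd, ha, ← h₂.2.2]
      refine intervalIntegral.integral_congr_uIoo fun x hx => ?_
      rw [Set.uIoo_of_le (not_le.1 hd).le] at hx
      simp [hx.1]
  refine ⟨Continuous.if_le h₁.1 h₂.1 continuous_id continuous_const ?_, hli, fun c d => ?_⟩
  · intro x hx; rw [show x = a from hx, ha]
  · rw [← intervalIntegral.integral_interval_sub_left (a := a) (ii_of_li hli _ _)
      (ii_of_li hli _ _), key, key]; ring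

lemma isPrim_lin (m c : ℝ) : IsPrim (fun x => m * x + c) (fun _ => m) :=
  ⟨by fun_prop, continuous_const.locallyIntegrable, fun a b => by simp; ring⟩

lemma lineH1_leftCut {f g : ℝ → ℝ} (h : LineH1 f g) (s : ℝ) :
    ∃ f₂ g₂, LineH1 f₂ g₂ ∧ (∀ x ≤ s - 1, f₂ x = 0) ∧ (∀ x > s, f₂ x = f x) ∧
      lineP 2 f₂ Set.univ ≤ lineP 2 f (Set.Ioi s) + ENNReal.ofReal (f s ^ 2) ∧
      lineP 2 g₂ Set.univ ≤ lineP 2 g (Set.Ioi s) + ENNReal.ofReal (f s ^ 2) := by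
  have p1 := (isPrim_lin 0 0).glue (isPrim_lin (f s) (f s * (1 - s))) (a := s - 1) (by ring)
  have p2 := p1.glue h.1 (a := s) (by
    rw [if_neg (by linarith)]; ring)
  set f₂ : ℝ → ℝ := (fun x => if x ≤ s then (if x ≤ s - 1 then 0 * x + 0
    else f s * x + f s * (1 - s)) else f x) with hf₂
  set g₂ : ℝ → ℝ := (fun x => if x ≤ s then (if x ≤ s - 1 then 0
    else f s) else g x) with hg₂
  have e : ENNReal.ofReal |f s| ^ (2:ℝ) * volume (Set.Ioc (s-1) s) = ENNReal.ofReal (f s ^ 2) := by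
    rw [Real.volume_Ioc, ENNReal.ofReal_rpow_of_nonneg (abs_nonneg _) (by norm_num)]
    simp
  have z1 : lineP 2 f₂ (Set.Iic (s-1)) = 0 :=
    lineP_eq_zero_of (by norm_num) measurableSet_Iic fun x hx => by
      have : x ≤ s - 1 := hx
      have h' : x ≤ s := by linarith
      simp [hf₂, this, h']
  have z2 : lineP 2 g₂ (Set.Iic (s-1)) = 0 :=
    lineP_eq_zero_of (by norm_num) measurableSet_Iic fun x hx => by
      have : x ≤ s - 1 := hx
      have h' : x ≤ s := by linarith
      simp [hg₂, this, h']
  have m1 : lineP 2 f₂ (Set.Ioc (s-1) s) ≤ ENNReal.ofReal (f s ^ 2) := by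
    rw [← e]
    refine lineP_le_of (by norm_num) measurableSet_Ioc fun x hx => ?_
    simp only [hf₂, hx.2, if_true, not_le.2 hx.1, if_false]
    rw [← mul_add, abs_mul]
    apply mul_le_of_le_one_right (abs_nonneg _)
    rw [abs_le]; constructor <;> linarith [hx.1, hx.2]
  have m2 : lineP 2 g₂ (Set.Ioc (s-1) s) ≤ ENNReal.ofReal (f s ^ 2) := by
    rw [← e]
    refine lineP_le_of (by norm_num) measurableSet_Ioc fun x hx => ?_
    simp only [hg₂, hx.2, if_true, not_le.2 hx.1, if_false]
    exact le_rfl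
  have r1 : lineP 2 f₂ (Set.Ioi s) = lineP 2 f (Set.Ioi s) :=
    lineP_congr measurableSet_Ioi fun x hx => by simp [hf₂, not_le.2 (show s < x from hx)]
  have r2 : lineP 2 g₂ (Set.Ioi s) = lineP 2 g (Set.Ioi s) :=
    lineP_congr measurableSet_Ioi fun x hx => by simp [hg₂, not_le.2 (show s < x from hx)]
  have b1 : lineP 2 f₂ Set.univ ≤ lineP 2 f (Set.Ioi s) + ENNReal.ofReal (f s ^ 2) := by
    rw [lineP_split 2 f₂ s, lineP_split' 2 f₂ (a := s - 1) (by linarith), z1, r1, zero_add, add_comm]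
    gcongr
  have b2 : lineP 2 g₂ Set.univ ≤ lineP 2 g (Set.Ioi s) + ENNReal.ofReal (f s ^ 2) := by
    rw [lineP_split 2 g₂ s, lineP_split' 2 g₂ (a := s - 1) (by linarith), z2, r2, zero_add, add_comm]
    gcongr
  refine ⟨f₂, g₂, ⟨p2, b1.trans_lt ?_, b2.trans_lt ?_⟩, ?_, ?_, b1, b2⟩
  · exact ENNReal.add_lt_top.2 ⟨(lineP_mono (Set.subset_univ _)).trans_lt h.2.1, by simp⟩
  · exact ENNReal.add_lt_top.2 ⟨(lineP_mono (Set.subset_univ _)).trans_lt h.2.2, by simp⟩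
  · intro x hx
    have h' : x ≤ s := by linarith
    simp [hf₂, hx, h']
  · intro x hx; simp [hf₂, not_le.2 (show s < x from hx)]

lemma lintegral_affine (F : ℝ → ℝ≥0∞) {c : ℝ} (hc : c ≠ 0) (d : ℝ) :
    ∫⁻ x, F (c * x + d) = ENNReal.ofReal |c⁻¹| * ∫⁻ x, F x := by
  rw [← lintegral_add_right_eq_self F d, ← smul_eq_mul, ← lintegral_smul_measure,
    ← Real.map_volume_mul_left hc]
  exact ((Homeomorph.mulLeft₀ c hc).measurableEmbedding.lintegral_map
    (fun x => F (x + d))).symm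

lemma lineP_affine (p : ℝ) (hp : 0 < p) (f : ℝ → ℝ) {c : ℝ} (hc : c ≠ 0) (b d : ℝ) :
    lineP p (fun x => b * f (c * x + d)) Set.univ
      = ENNReal.ofReal (|b| ^ p * |c|⁻¹) * lineP p f Set.univ := by
  unfold lineP
  simp only [Measure.restrict_univ, nnnorm_mul, ENNReal.coe_mul,
    ENNReal.mul_rpow_of_nonneg _ _ hp.le]
  rw [lintegral_const_mul' _ _ (by simp [hp.le]),
    lintegral_affine (fun x => (‖f x‖₊ : ℝ≥0∞) ^ p) hc, ← mul_assoc,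
    ENNReal.ofReal_mul (by positivity), ← ENNReal.ofReal_rpow_of_nonneg (abs_nonneg _) hp.le,
    ← enorm_eq_nnnorm, Real.enorm_eq_ofReal_abs, abs_inv]

lemma LineH1.affine {f g : ℝ → ℝ} (h : LineH1 f g) {c : ℝ} (hc : c ≠ 0) (b d : ℝ) :
    LineH1 (fun x => b * f (c * x + d)) (fun x => (b * c) * g (c * x + d)) := by
  refine ⟨⟨?_, ?_, ?_⟩, ?_, ?_⟩
  · have := h.1.1; fun_prop
  · refine li_of_ii fun x y => IntervalIntegrable.const_mul ?_ _
    have := ((h.1.ii (c * x + d) (c * y + d)).comp_add_right d).comp_mul_left (c := c)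
    simpa [hc] using this
  · intro x y
    rw [intervalIntegral.integral_const_mul, mul_assoc, intervalIntegral.mul_integral_comp_mul_add, h.1.2.2]
    ring
  · rw [lineP_affine _ (by norm_num) _ hc]; exact ENNReal.mul_lt_top (by simp) h.2.1
  · rw [lineP_affine _ (by norm_num) _ hc]; exact ENNReal.mul_lt_top (by simp) h.2.2

lemma lineP_reflect (p : ℝ) {f f' : ℝ → ℝ} (h : ∀ x, |f' x| = |f (-x)|) (s : ℝ) :
    lineP p f' (Set.Ioi (-s)) = lineP p f (Set.Iic s) := by
  rw [← lineP_Iio_eq]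
  unfold lineP
  rw [← lintegral_indicator measurableSet_Ioi, ← lintegral_indicator measurableSet_Iio]
  have := lintegral_affine ((Set.Iio s).indicator fun x => (‖f x‖₊ : ℝ≥0∞) ^ p)
    (c := -1) (by norm_num) 0
  rw [show ENNReal.ofReal |(-1:ℝ)⁻¹| = 1 by norm_num, one_mul] at this
  rw [← this]
  refine lintegral_congr fun x => ?_
  have e : ‖f' x‖₊ = ‖f (-x)‖₊ := by
    ext; simpa using h x
  by_cases hx : -s < x
  · have : -x < s := by linarith
    simp [Set.indicator, hx, this, e]
  · have : ¬ (-x < s) := by linarith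
    simp [Set.indicator, hx, this]

lemma lineP_reflect_univ (p : ℝ) {f f' : ℝ → ℝ} (h : ∀ x, |f' x| = |f (-x)|) :
    lineP p f' Set.univ = lineP p f Set.univ := by
  have e : ∀ x, ‖f' x‖₊ = ‖f (-x)‖₊ := fun x => by ext; simpa using h x
  unfold lineP
  simp only [Measure.restrict_univ, e]
  have := lintegral_affine (fun x => (‖f x‖₊ : ℝ≥0∞) ^ p)
    (c := -1) (by norm_num) 0
  rw [show ENNReal.ofReal |(-1:ℝ)⁻¹| = 1 by norm_num, one_mul] at this
  rw [← this]; simp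

lemma LineH1.reflect {f g : ℝ → ℝ} (h : LineH1 f g) :
    LineH1 (fun x => f (-x)) (fun x => - g (-x)) := by
  simpa using h.affine (c := -1) (by norm_num) 1 0

lemma zero_of_lineP {p : ℝ} (hp : 0 < p) {f : ℝ → ℝ} (hf : Continuous f) {U : Set ℝ} (hU : IsOpen U)
    (h : lineP p f U = 0) : ∀ x ∈ U, f x = 0 := by
  have hm : Measurable fun x => (‖f x‖₊ : ℝ≥0∞) ^ p := by
    have := hf.measurable; fun_prop
  rw [lineP, lintegral_eq_zero_iff hm] at h
  have h2 : f =ᵐ[volume.restrict U] fun _ => 0 := by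
    filter_upwards [h] with x hx
    simpa [hp, hp.le, hp.not_gt] using hx
  exact Measure.eqOn_open_of_ae_eq h2 hU hf.continuousOn continuousOn_const

lemma prim_cs {f g : ℝ → ℝ} (h : IsPrim f g) {a s : ℝ} (has : a ≤ s) :
    ENNReal.ofReal ((f s - f a) ^ 2) ≤ ENNReal.ofReal (s - a) * lineP 2 g (Set.Ioc a s) := by
  have h1 : ENNReal.ofReal |f s - f a| ≤ ∫⁻ x in Set.Ioc a s, ‖g x‖ₑ := by
    rw [← h.2.2, intervalIntegral.integral_of_le has, ← Real.enorm_eq_ofReal_abs]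
    exact enorm_integral_le_lintegral_enorm _
  have hg : AEMeasurable (fun x => ‖g x‖ₑ) (volume.restrict (Set.Ioc a s)) :=
    (h.ii a s).1.aestronglyMeasurable.enorm
  have h2 := ENNReal.lintegral_mul_le_Lp_mul_Lq (volume.restrict (Set.Ioc a s))
    (Real.HolderConjugate.two_two) hg (g := fun _ => 1) aemeasurable_const
  simp only [Pi.mul_apply, mul_one, ENNReal.one_rpow, lintegral_const, one_mul,
    Measure.restrict_apply_univ, Real.volume_Ioc] at h2
  have h3 := pow_le_pow_left₀ zero_le (h1.trans h2) 2
  rw [← ENNReal.ofReal_pow (abs_nonneg _), sq_abs, mul_pow, ← ENNReal.rpow_natCast,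
    ← ENNReal.rpow_natCast, ← ENNReal.rpow_mul, ← ENNReal.rpow_mul] at h3
  norm_num at h3
  rw [mul_comm]
  simpa [lineP, enorm_eq_nnnorm] using h3

lemma exists_small {f : ℝ → ℝ} (h : lineP 2 f Set.univ < ⊤) {ε : ℝ} (hε : 0 < ε) (s₀ : ℝ) :
    ∃ s ≤ s₀, f s ^ 2 ≤ ε := by
  by_contra! hc
  have h1 : ∫⁻ x in Set.Iic s₀, ENNReal.ofReal ε ≤ lineP 2 f (Set.Iic s₀) := by
    refine setLIntegral_mono' measurableSet_Iic fun x hx => ?_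
    rw [← enorm_eq_nnnorm, Real.enorm_eq_ofReal_abs,
      ENNReal.ofReal_rpow_of_nonneg (abs_nonneg _) (by norm_num)]
    refine ENNReal.ofReal_le_ofReal ?_
    have := (hc x hx).le
    simpa using this
  have h2 := h1.trans_lt ((lineP_mono (Set.subset_univ _)).trans_lt h)
  simp [ENNReal.mul_top, hε] at h2

lemma exists_tail {p : ℝ} {f : ℝ → ℝ} {c : ℝ≥0∞} (h : c < lineP p f Set.univ) :
    ∃ s₀ : ℝ, ∀ s ≤ s₀, c < lineP p f (Set.Ioi s) := by
  have hu : (⋃ n : ℕ, Set.Ioi (-(n:ℝ))) = Set.univ := by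
    ext x; simp only [Set.mem_iUnion, Set.mem_Ioi, Set.mem_univ, iff_true]
    obtain ⟨n, hn⟩ := exists_nat_gt (-x)
    exact ⟨n, by linarith⟩
  rw [← hu, lineP, setLIntegral_iUnion_of_directed, lt_iSup_iff] at h
  · obtain ⟨n, hn⟩ := h
    exact ⟨-n, fun s hs => hn.trans_le (lineP_mono (Set.Ioi_subset_Ioi hs))⟩
  · refine Monotone.directed_le fun m n hmn => Set.Ioi_subset_Ioi ?_
    simpa using hmn

lemma left_approx {f g : ℝ → ℝ} (h : LineH1 f g) {q : ℝ≥0∞} (hq : q ≠ ⊤)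
    (hA : q * lineP 2 f Set.univ ^ 2 * lineP 2 g Set.univ < lineP 6 f Set.univ) :
    ∃ f₂ g₂ s, LineH1 f₂ g₂ ∧ (∀ x ≤ s - 1, f₂ x = 0) ∧ (∀ x > s, f₂ x = f x) ∧
      q * lineP 2 f₂ Set.univ ^ 2 * lineP 2 g₂ Set.univ < lineP 6 f₂ Set.univ := by
  set B := lineP 2 f Set.univ with hB
  set C := lineP 2 g Set.univ with hC
  obtain ⟨ε, hε, hε2⟩ : ∃ ε : ℝ, 0 < ε ∧
      q * (B + ENNReal.ofReal ε) ^ 2 * (C + ENNReal.ofReal ε) < lineP 6 f Set.univ := by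
    have ht : Tendsto (fun ε : ℝ => q * (B + ENNReal.ofReal ε) ^ 2 * (C + ENNReal.ofReal ε))
        (𝓝[>] 0) (𝓝 (q * (B + ENNReal.ofReal 0) ^ 2 * (C + ENNReal.ofReal 0))) := by
      have t0 : Tendsto (fun ε : ℝ => ENNReal.ofReal ε) (𝓝[>] 0) (𝓝 (ENNReal.ofReal 0)) :=
        (ENNReal.continuous_ofReal.tendsto 0).mono_left nhdsWithin_le_nhds
      have hBt : B ≠ ⊤ := h.2.1.ne
      have hCt : C ≠ ⊤ := h.2.2.ne
      refine ENNReal.Tendsto.mul (ENNReal.Tendsto.const_mul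
        (ENNReal.Tendsto.pow (tendsto_const_nhds.add t0)) (Or.inr hq)) (Or.inr ?_)
        (tendsto_const_nhds.add t0) (Or.inr ?_)
      · simpa using hCt
      · exact ENNReal.mul_ne_top hq (by simpa using hBt)
    simp only [ENNReal.ofReal_zero, add_zero] at ht
    obtain ⟨ε, h1, h2⟩ := ((ht.eventually (gt_mem_nhds hA)).and self_mem_nhdsWithin).exists
    exact ⟨ε, h2, h1⟩
  obtain ⟨s₀, hs₀⟩ := exists_tail hε2
  obtain ⟨s, hs, hfs⟩ := exists_small h.2.1 hε s₀
  obtain ⟨f₂, g₂, H, h0, he, hb, hc⟩ := lineH1_leftCut h s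
  refine ⟨f₂, g₂, s, H, h0, he, ?_⟩
  have e : lineP 6 f₂ (Set.Ioi s) = lineP 6 f (Set.Ioi s) :=
    lineP_congr measurableSet_Ioi fun x hx => he x hx
  calc _ ≤ q * (B + ENNReal.ofReal ε) ^ 2 * (C + ENNReal.ofReal ε) := by
        gcongr
        · exact hb.trans (add_le_add (lineP_mono (Set.subset_univ _)) (ENNReal.ofReal_le_ofReal hfs))
        · exact hc.trans (add_le_add (lineP_mono (Set.subset_univ _)) (ENNReal.ofReal_le_ofReal hfs))
    _ < lineP 6 f (Set.Ioi s) := hs₀ s hs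
    _ ≤ _ := by rw [← e]; exact lineP_mono (Set.subset_univ _)

lemma compact_approx {f g : ℝ → ℝ} (h : LineH1 f g) {q : ℝ≥0∞} (hq : q ≠ ⊤)
    (hA : q * lineP 2 f Set.univ ^ 2 * lineP 2 g Set.univ < lineP 6 f Set.univ) :
    ∃ f₂ g₂ R, LineH1 f₂ g₂ ∧ (∀ x, R < |x| → f₂ x = 0) ∧
      q * lineP 2 f₂ Set.univ ^ 2 * lineP 2 g₂ Set.univ < lineP 6 f₂ Set.univ := by
  obtain ⟨f₁, g₁, s, H1, hz, -, hA1⟩ := left_approx h hq hA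
  have H1' := H1.reflect
  have ef : ∀ p, lineP p (fun x => f₁ (-x)) Set.univ = lineP p f₁ Set.univ := fun p =>
    lineP_reflect_univ p (fun x => rfl)
  have eg : lineP 2 (fun x => -g₁ (-x)) Set.univ = lineP 2 g₁ Set.univ :=
    lineP_reflect_univ 2 (fun x => abs_neg _)
  obtain ⟨f₂, g₂, t, H2, hz2, he2, hA2⟩ := left_approx H1' hq (by rw [ef, ef, eg]; exact hA1)
  refine ⟨f₂, g₂, |s - 1| + |t| + 1, H2, fun x hx => ?_, hA2⟩
  by_cases hxt : x ≤ t - 1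
  · exact hz2 x hxt
  · have hx0 : 0 ≤ x := by
      by_contra hneg
      rw [abs_of_neg (not_le.1 hneg)] at hx
      linarith [neg_abs_le t, abs_nonneg (s-1)]
    rw [abs_of_nonneg hx0] at hx
    rw [he2 x (by linarith [le_abs_self t, abs_nonneg (s-1)])]
    exact hz _ (by linarith [neg_abs_le (s-1), abs_nonneg t])

/-- the sharp line inequality with constant `K` -/
def LineGN (K : ℝ) : Prop := ∀ f g : ℝ → ℝ, LineH1 f g →
  lineP 6 f Set.univ ≤ ENNReal.ofReal K * lineP 2 f Set.univ ^ 2 * lineP 2 g Set.univ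

lemma half_right {K : ℝ} (hL : LineGN K) {f g : ℝ → ℝ} (h : LineH1 f g) {s : ℝ} (hs : f s = 0) :
    lineP 6 f (Set.Ioi s) ≤
      ENNReal.ofReal K * lineP 2 f (Set.Ioi s) ^ 2 * lineP 2 g (Set.Ioi s) := by
  obtain ⟨f₂, g₂, H, -, he, hb, hc⟩ := lineH1_leftCut h s
  rw [hs] at hb hc
  simp only [ne_eq, OfNat.ofNat_ne_zero, not_false_eq_true, zero_pow, ENNReal.ofReal_zero,
    add_zero] at hb hc
  have e : lineP 6 f₂ (Set.Ioi s) = lineP 6 f (Set.Ioi s) :=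
    lineP_congr measurableSet_Ioi fun x hx => he x hx
  calc _ ≤ lineP 6 f₂ Set.univ := by rw [← e]; exact lineP_mono (Set.subset_univ _)
    _ ≤ _ := hL _ _ H
    _ ≤ _ := by gcongr

lemma half_left {K : ℝ} (hL : LineGN K) {f g : ℝ → ℝ} (h : LineH1 f g) {s : ℝ} (hs : f s = 0) :
    lineP 6 f (Set.Iic s) ≤
      ENNReal.ofReal K * lineP 2 f (Set.Iic s) ^ 2 * lineP 2 g (Set.Iic s) := by
  have := half_right hL h.reflect (s := -s) (by simpa using hs)
  rwa [lineP_reflect 6 (f := f) (fun x => rfl), lineP_reflect 2 (f := f) (fun x => rfl),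
    lineP_reflect 2 (f := g) (fun x => abs_neg _)] at this

lemma eta_real {K b c c1 c2 m η d : ℝ} (hK : 0 < K) (hb : 0 < b) (hc : 0 ≤ c) (hm : 0 < m)
    (hm1 : m ≤ 1) (hη : 0 < η) (hη1 : η ≤ 1) (hd : d ≤ η) (h1 : c1 + c2 ≤ c) (h2 : m ≤ d * c1)
    (hc1 : 0 ≤ c1)
    (h3 : K * b ^ 2 * c ≤ m ^ 3 * d + K * (b + m) ^ 2 * (c2 + m))
    (h4 : 1 + K * (2 * b + 1) * c < K * b ^ 2 * (1 / η - 1)) : False := by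
  have e1 : m / η ≤ c1 := by rw [div_le_iff₀ hη]; nlinarith
  have e2 : m ≤ m / η := by rw [le_div_iff₀ hη]; nlinarith
  have e3 : c2 + m ≤ c - (m / η - m) := by linarith
  have e4 : m ^ 3 * d ≤ m := by
    have : m ^ 3 ≤ m := by nlinarith [mul_nonneg hm.le (sq_nonneg m), mul_pos hm hm]
    have h0 : 0 ≤ m ^ 3 := by positivity
    nlinarith
  have e5 : K * (b + m) ^ 2 * (c2 + m) ≤ K * (b + m) ^ 2 * (c - (m / η - m)) := by gcongr
  have e6 : K * (b + m) ^ 2 * (c - (m / η - m)) ≤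
      K * b ^ 2 * (c - (m / η - m)) + K * (m * (2 * b + 1)) * c := by
    have : 0 ≤ m / η - m := by linarith
    have i1 : 0 ≤ K * (2 * b * m + m ^ 2) * (m / η - m) := by positivity
    have i2 : K * (2 * b * m + m ^ 2) * c ≤ K * (m * (2 * b + 1)) * c := by
      gcongr; nlinarith
    nlinarith
  have e7 : m / η - m = m * (1 / η - 1) := by ring
  rw [e7] at e5 e6
  have e8 := mul_lt_mul_of_pos_left h4 hm
  nlinarith [e8]

lemma eta_contra {K : ℝ} (hK : 0 < K) (hL : LineGN K) {f g : ℝ → ℝ} (h : LineH1 f g) {a : ℝ}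
    (h0 : ∀ x ≤ a, f x = 0) (hn : ∀ η > 0, ∃ y, a < y ∧ y < a + η ∧ f y ≠ 0)
    (hA : lineP 6 f Set.univ = ENNReal.ofReal K * lineP 2 f Set.univ ^ 2 * lineP 2 g Set.univ) :
    False := by
  have hBt := h.2.1.ne
  have hCt := h.2.2.ne
  set B := lineP 2 f Set.univ with hB
  set C := lineP 2 g Set.univ with hC
  have hb : 0 < B.toReal := by
    refine ENNReal.toReal_pos (fun hz => ?_) hBt
    obtain ⟨y, -, -, hy⟩ := hn 1 one_pos
    exact hy (zero_of_lineP (by norm_num) h.1.1 isOpen_univ hz y trivial)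
  have hc : 0 ≤ C.toReal := ENNReal.toReal_nonneg
  set b := B.toReal with hbdef
  set c := C.toReal with hcdef
  obtain ⟨δ, hδ, hδ1⟩ : ∃ δ > 0, ∀ x, |x - a| < δ → |f x| < 1 := by
    obtain ⟨δ, hδ, H⟩ := Metric.continuous_iff.1 h.1.1 a 1 one_pos
    refine ⟨δ, hδ, fun x hx => ?_⟩
    simpa [Real.dist_eq, h0 a le_rfl] using H x (by simpa [Real.dist_eq] using hx)
  set T := (1 + K * (2 * b + 1) * c) / (K * b ^ 2) with hT
  have hTpos : 0 < T := by positivity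
  obtain ⟨η, hη, hη1, hηδ, hηT⟩ : ∃ η : ℝ, 0 < η ∧ η ≤ 1 ∧ η < δ ∧
      1 + K * (2 * b + 1) * c < K * b ^ 2 * (1 / η - 1) := by
    have hp : 0 < min (1 / (T + 2)) (δ / 2) := by positivity
    refine ⟨min (1 / (T + 2)) (δ / 2), hp, ?_, ?_, ?_⟩
    · refine (min_le_left _ _).trans ?_
      rw [div_le_one (by linarith)]; linarith
    · exact (min_le_right _ _).trans_lt (by linarith)
    · have : T + 2 ≤ 1 / min (1 / (T + 2)) (δ / 2) := by
        rw [le_div_iff₀ hp]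
        calc _ ≤ (T + 2) * (1 / (T + 2)) := by gcongr; exact min_le_left _ _
          _ = 1 := by field_simp
      have h2 : K * b ^ 2 * T = 1 + K * (2 * b + 1) * c := by rw [hT]; field_simp
      rw [← h2]
      have : 0 < K * b ^ 2 := by positivity
      gcongr
      linarith
  obtain ⟨s, hs, hmax⟩ := (isCompact_Icc (a := a) (b := a + η)).exists_isMaxOn
    ⟨a, by simp [hη.le]⟩ (h.1.1.abs.continuousOn)
  obtain ⟨y, hy1, hy2, hy3⟩ := hn η hη
  have hM : 0 < |f s| := (abs_pos.2 hy3).trans_le (hmax ⟨hy1.le, hy2.le⟩)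
  have hsa : a < s := by
    by_contra hcon
    rw [h0 s (not_lt.1 hcon)] at hM; simp at hM
  have hM1 : |f s| ≤ 1 := (hδ1 s (by rw [abs_of_pos (by linarith)]; linarith [hs.2])).le
  have cs := prim_cs h.1 hsa.le
  rw [h0 a le_rfl, sub_zero] at cs
  obtain ⟨f₂, g₂, H, -, he, hb2, hc2⟩ := lineH1_leftCut h s
  have e : lineP 6 f₂ (Set.Ioi s) = lineP 6 f (Set.Ioi s) :=
    lineP_congr measurableSet_Ioi fun x hx => he x hx
  have k1 : lineP 6 f (Set.Ioi s) ≤ ENNReal.ofReal K * (B + ENNReal.ofReal (f s ^ 2)) ^ 2 *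
      (lineP 2 g (Set.Ioi s) + ENNReal.ofReal (f s ^ 2)) := by
    calc _ ≤ lineP 6 f₂ Set.univ := by rw [← e]; exact lineP_mono (Set.subset_univ _)
      _ ≤ _ := hL _ _ H
      _ ≤ _ := by
        gcongr
        exact hb2.trans (add_le_add_left (lineP_mono (Set.subset_univ _)) _)
  have k2 : lineP 6 f (Set.Iic s) ≤ ENNReal.ofReal (|f s| ^ 6 * (s - a)) := by
    rw [lineP_split' 6 f hsa.le, lineP_eq_zero_of (by norm_num) measurableSet_Iic h0, zero_add]
    refine (lineP_le_of (M := |f s|) (by norm_num) measurableSet_Ioc fun x hx =>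
      hmax ⟨hx.1.le, hx.2.trans hs.2⟩).trans ?_
    rw [Real.volume_Ioc, ENNReal.ofReal_rpow_of_nonneg (abs_nonneg _) (by norm_num),
      ← ENNReal.ofReal_mul (by positivity)]
    norm_cast
  have k3 : lineP 2 g (Set.Ioc a s) + lineP 2 g (Set.Ioi s) ≤ C := by
    rw [hC, lineP_split 2 g s, lineP_split' 2 g hsa.le]
    gcongr
    exact le_add_self
  have k4 := lineP_split 6 f s
  rw [hA] at k4
  have t1 : lineP 2 g (Set.Ioc a s) ≠ ⊤ := ((lineP_mono (Set.subset_univ _)).trans_lt h.2.2).ne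
  have t2 : lineP 2 g (Set.Ioi s) ≠ ⊤ := ((lineP_mono (Set.subset_univ _)).trans_lt h.2.2).ne
  refine eta_real (K := K) (b := b) (c := c) (c1 := (lineP 2 g (Set.Ioc a s)).toReal)
    (c2 := (lineP 2 g (Set.Ioi s)).toReal) (m := f s ^ 2) (η := η) (d := s - a) hK hb hc
    (by rw [← sq_abs]; positivity) (by rw [← sq_abs]; exact pow_le_one₀ (abs_nonneg _) hM1) hη hη1
    (by linarith [hs.2]) ?_ ?_ ENNReal.toReal_nonneg ?_ hηT
  · rw [← ENNReal.toReal_add t1 t2]; exact ENNReal.toReal_mono hCt k3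
  · have := ENNReal.toReal_mono (ENNReal.mul_ne_top ENNReal.ofReal_ne_top t1) cs
    rwa [ENNReal.toReal_ofReal (by positivity), ENNReal.toReal_mul,
      ENNReal.toReal_ofReal (by linarith)] at this
  · have := k4.trans_le (add_le_add k2 k1)
    have := ENNReal.toReal_mono (by
      refine ENNReal.add_ne_top.2 ⟨ENNReal.ofReal_ne_top, ENNReal.mul_ne_top (ENNReal.mul_ne_top
        ENNReal.ofReal_ne_top (ENNReal.pow_ne_top ?_)) ?_⟩
      · exact ENNReal.add_ne_top.2 ⟨hBt, ENNReal.ofReal_ne_top⟩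
      · exact ENNReal.add_ne_top.2 ⟨t2, ENNReal.ofReal_ne_top⟩) this
    rw [ENNReal.toReal_add ENNReal.ofReal_ne_top (ENNReal.mul_ne_top (ENNReal.mul_ne_top
        ENNReal.ofReal_ne_top (ENNReal.pow_ne_top (ENNReal.add_ne_top.2 ⟨hBt, ENNReal.ofReal_ne_top⟩)))
        (ENNReal.add_ne_top.2 ⟨t2, ENNReal.ofReal_ne_top⟩)), ENNReal.toReal_mul, ENNReal.toReal_mul,
        ENNReal.toReal_mul, ENNReal.toReal_mul, ENNReal.toReal_pow, ENNReal.toReal_pow,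
        ENNReal.toReal_add hBt ENNReal.ofReal_ne_top, ENNReal.toReal_add t2 ENNReal.ofReal_ne_top,
        ENNReal.toReal_ofReal (mul_nonneg (by positivity : (0:ℝ) ≤ |f s| ^ 6)
          (sub_nonneg.2 hsa.le)),
        ENNReal.toReal_ofReal hK.le, ENNReal.toReal_ofReal (sq_nonneg (f s))] at this
    rw [show (f s ^ 2) ^ 3 = |f s| ^ 6 by rw [← sq_abs]; ring]
    exact this

lemma split_real {K b1 b2 c1 c2 : ℝ} (hK : 0 < K) (hb1 : 0 ≤ b1) (hb2 : 0 < b2) (hc1 : 0 ≤ c1)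
    (hc2 : 0 < c2)
    (h : K * (b1 + b2) ^ 2 * (c1 + c2) ≤ K * b1 ^ 2 * c1 + K * b2 ^ 2 * c2) : b1 = 0 := by
  by_contra hne
  have hb1' : 0 < b1 := lt_of_le_of_ne hb1 (Ne.symm hne)
  have i1 : 0 < K * b1 ^ 2 * c2 := by positivity
  have i2 : 0 ≤ K * b2 ^ 2 * c1 := by positivity
  have i3 : 0 ≤ K * (2 * b1 * b2) * (c1 + c2) := by positivity
  nlinarith

lemma no_equality {K : ℝ} (hK : 0 < K) (hL : LineGN K) {f g : ℝ → ℝ} (h : LineH1 f g)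
    (hz : ∀ n : ℤ, f n = 0) (hn : ∃ x, f x ≠ 0)
    (hA : lineP 6 f Set.univ = ENNReal.ofReal K * lineP 2 f Set.univ ^ 2 * lineP 2 g Set.univ) :
    False := by
  obtain ⟨x₀, hx₀⟩ := hn
  set n : ℝ := ((⌊x₀⌋ : ℤ) : ℝ) with hndef
  have hfn : f n = 0 := hz _
  have hnx : n < x₀ := lt_of_le_of_ne (Int.floor_le x₀) (fun he => hx₀ (he ▸ hfn))
  have tf : ∀ S, lineP 2 f S ≠ ⊤ := fun S => ((lineP_mono (Set.subset_univ _)).trans_lt h.2.1).ne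
  have tg : ∀ S, lineP 2 g S ≠ ⊤ := fun S => ((lineP_mono (Set.subset_univ _)).trans_lt h.2.2).ne
  have hb2 : lineP 2 f (Set.Ioi n) ≠ 0 := fun hz' =>
    hx₀ (zero_of_lineP (by norm_num) h.1.1 isOpen_Ioi hz' x₀ hnx)
  have hc2 : lineP 2 g (Set.Ioi n) ≠ 0 := fun hz' => by
    have := prim_cs h.1 hnx.le
    rw [le_antisymm ((lineP_mono Set.Ioc_subset_Ioi_self).trans hz'.le) zero_le, mul_zero, hfn] at this
    have h2 : 0 < f x₀ ^ 2 := by positivity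
    simp only [nonpos_iff_eq_zero, ENNReal.ofReal_eq_zero, sub_zero] at this
    linarith
  have hsum := hA.symm.trans_le ((lineP_split 6 f n).trans_le
    (add_le_add (half_left hL h hfn) (half_right hL h hfn)))
  rw [lineP_split 2 f n, lineP_split 2 g n] at hsum
  have tt : ∀ S, ENNReal.ofReal K * lineP 2 f S ^ 2 * lineP 2 g S ≠ ⊤ := fun S =>
    ENNReal.mul_ne_top (ENNReal.mul_ne_top ENNReal.ofReal_ne_top (ENNReal.pow_ne_top (tf S))) (tg S)
  have hr := ENNReal.toReal_mono (ENNReal.add_ne_top.2 ⟨tt _, tt _⟩) hsum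
  rw [ENNReal.toReal_add (tt _) (tt _)] at hr
  simp only [ENNReal.toReal_mul, ENNReal.toReal_pow, ENNReal.toReal_add (tf _) (tf _),
    ENNReal.toReal_add (tg _) (tg _), ENNReal.toReal_ofReal hK.le] at hr
  have hb1 := split_real hK ENNReal.toReal_nonneg (ENNReal.toReal_pos hb2 (tf _))
    ENNReal.toReal_nonneg (ENNReal.toReal_pos hc2 (tg _)) hr
  have hb1' : lineP 2 f (Set.Iio n) = 0 := by
    rw [lineP_Iio_eq]
    exact ((ENNReal.toReal_eq_zero_iff _).1 hb1).resolve_right (tf _)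
  have hleft := zero_of_lineP (by norm_num) h.1.1 isOpen_Iio hb1'
  -- leftmost point of the support
  set Z : Set ℝ := {x | ∀ y ≤ x, f y = 0} with hZ
  have hnZ : n ∈ Z := fun y hy => by
    rcases hy.lt_or_eq with h1 | h1
    · exact hleft y h1
    · rw [h1]; exact hfn
  have hbdd : BddAbove Z := ⟨x₀, fun x hx => by
    by_contra hcon
    exact hx₀ (hx x₀ (not_le.1 hcon).le)⟩
  have hlt : ∀ x < sSup Z, f x = 0 := fun x hx => by
    obtain ⟨z, hzZ, hxz⟩ := exists_lt_of_lt_csSup ⟨n, hnZ⟩ hx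
    exact hzZ x hxz.le
  have hle : ∀ x ≤ sSup Z, f x = 0 := by
    have hcl : IsClosed {x | f x = 0} := isClosed_eq h.1.1 continuous_const
    have : closure (Set.Iio (sSup Z)) ⊆ {x | f x = 0} :=
      closure_minimal (fun x hx => hlt x hx) hcl
    rw [closure_Iio] at this
    exact fun x hx => this hx
  refine eta_contra hK hL h hle (fun η hη => ?_) hA
  by_contra! hcon
  have hmem : sSup Z + η / 2 ∈ Z := fun y hy => by
    by_cases hy1 : y ≤ sSup Z
    · exact hle y hy1
    · exact hcon y (not_le.1 hy1) (by linarith)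
  linarith [le_csSup hbdd hmem]

/-- all lines of the grid function, indexed by a sum type -/
def GridFunc.line (u : GridFunc) : ℤ ⊕ ℤ → ℝ → ℝ := Sum.elim u.h u.w
/-- derivatives along the lines -/
def GridFunc.dline (u : GridFunc) : ℤ ⊕ ℤ → ℝ → ℝ := Sum.elim u.hd u.wd

lemma grid_sum (p : ℝ) (f g : ℤ → ℝ → ℝ) :
    gridLpPow p f g = ∑' i, lineP p (Sum.elim f g i) Set.univ := by
  rw [Summable.tsum_sum ENNReal.summable ENNReal.summable]
  simp [gridLpPow, lineP]

lemma memH1_line {u : GridFunc} (hu : u.MemH1) (i : ℤ ⊕ ℤ) : LineH1 (u.line i) (u.dline i) := by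
  obtain ⟨h1, h2, h3, h4, h5, h6, h7, h8⟩ := hu
  rw [grid_sum] at h7 h8
  refine ⟨?_, (ENNReal.le_tsum i).trans_lt h7, (ENNReal.le_tsum i).trans_lt h8⟩
  rcases i with j | k
  · refine ⟨h1 j, h3 j, fun a b => ?_⟩
    have := intervalIntegral.integral_interval_sub_left (ii_of_li (h3 j) 0 b) (ii_of_li (h3 j) 0 a)
    simp only [GridFunc.line, GridFunc.dline, Sum.elim_inl]
    rw [← this, h5, h5]; ring
  · refine ⟨h2 k, h4 k, fun a b => ?_⟩
    have := intervalIntegral.integral_interval_sub_left (ii_of_li (h4 k) 0 b) (ii_of_li (h4 k) 0 a)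
    simp only [GridFunc.line, GridFunc.dline, Sum.elim_inr]
    rw [← this, h6, h6]; ring

lemma grid_gn {q : ℝ} (hL : LineGN q) {u : GridFunc} (hu : u.MemH1) :
    gridLpPow 6 u.h u.w ≤
      ENNReal.ofReal q * gridLpPow 2 u.h u.w ^ 2 * gridLpPow 2 u.hd u.wd := by
  rw [grid_sum 6, grid_sum 2 u.hd, ← ENNReal.tsum_mul_left]
  refine ENNReal.tsum_le_tsum fun i => (hL _ _ (memH1_line hu i)).trans ?_
  rw [grid_sum]
  gcongr
  · exact ENNReal.le_tsum (f := fun i => lineP 2 (Sum.elim u.h u.w i) Set.univ) i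
  · exact le_rfl

lemma grid_gn_real {q : ℝ} (hq : 0 ≤ q) (hL : LineGN q) {u : GridFunc} (hu : u.MemH1) :
    (gridLpPow 6 u.h u.w).toReal ≤
      q * (gridLpPow 2 u.h u.w).toReal ^ 2 * (gridLpPow 2 u.hd u.wd).toReal := by
  have := ENNReal.toReal_mono (ENNReal.mul_ne_top (ENNReal.mul_ne_top ENNReal.ofReal_ne_top
    (ENNReal.pow_ne_top hu.2.2.2.2.2.2.1.ne)) hu.2.2.2.2.2.2.2.ne) (grid_gn hL hu)
  simpa [ENNReal.toReal_mul, ENNReal.toReal_ofReal hq] using this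

/-- a function on a single line, vanishing at the vertices -/
def ofLine (f g : ℝ → ℝ) (hz : ∀ n : ℤ, f n = 0) : GridFunc where
  h j := if j = 0 then f else 0
  w _ := 0
  hd j := if j = 0 then g else 0
  wd _ := 0
  compat j k := by by_cases hj : j = 0 <;> simp [hj, hz]

lemma ofLine_sum {p : ℝ} (hp : 0 < p) (f : ℝ → ℝ) :
    gridLpPow p (fun j => if j = 0 then f else 0) (fun _ => 0) = lineP p f Set.univ := by
  have h0 : ∫⁻ (x : ℝ), (‖(0 : ℝ → ℝ) x‖₊ : ℝ≥0∞) ^ p = 0 := by simp [hp]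
  rw [gridLpPow, tsum_eq_single 0]
  · simp [hp, lineP]
  · intro j hj; rw [if_neg hj]; exact h0

lemma ofLine_memH1 {f g : ℝ → ℝ} (h : LineH1 f g) (hz : ∀ n : ℤ, f n = 0) :
    (ofLine f g hz).MemH1 := by
  refine ⟨fun j => ?_, fun k => continuous_const, fun j => ?_, fun k => locallyIntegrable_zero,
    fun j x => ?_, fun k x => by simp [ofLine], ?_, ?_⟩
  · by_cases hj : j = 0
    · simpa [ofLine, hj] using h.1.1
    · simpa [ofLine, hj] using continuous_zero
  · by_cases hj : j = 0
    · simpa [ofLine, hj] using h.1.2.1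
    · show LocallyIntegrable (if j = 0 then g else 0)
      rw [if_neg hj]; exact locallyIntegrable_zero
  · by_cases hj : j = 0
    · simpa [ofLine, hj] using h.1.2.2 0 x
    · simp [ofLine, hj]
  · exact (ofLine_sum (by norm_num) f).trans_lt h.2.1
  · exact (ofLine_sum (by norm_num) g).trans_lt h.2.2

lemma scale_embed {f g : ℝ → ℝ} (h : LineH1 f g) {R : ℝ} (hR : ∀ x, R < |x| → f x = 0)
    {α lam : ℝ} (hα : 0 < α) (hl : 0 < lam) (hlR : 2 * R < lam) :
    ∃ u : GridFunc, u.MemH1 ∧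
      gridLpPow 2 u.h u.w = ENNReal.ofReal (α ^ 2) * lineP 2 f Set.univ ∧
      gridLpPow 2 u.hd u.wd = ENNReal.ofReal (α ^ 2 * lam ^ 2) * lineP 2 g Set.univ ∧
      gridLpPow 6 u.h u.w = ENNReal.ofReal (α ^ 6 * lam ^ 2) * lineP 6 f Set.univ := by
  have hs : √lam ^ 2 = lam := Real.sq_sqrt hl.le
  have H := h.affine hl.ne' (α * √lam) (-lam / 2)
  have hz : ∀ n : ℤ, (fun x => α * √lam * f (lam * x + -lam / 2)) (n : ℝ) = 0 := by
    intro n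
    show α * √lam * f (lam * n + -lam / 2) = 0
    rw [hR, mul_zero]
    have e : lam * n + -lam / 2 = lam / 2 * ((2 * n - 1 : ℤ) : ℝ) := by push_cast; ring
    rw [e, abs_mul, abs_of_pos (show 0 < lam / 2 by linarith), ← Int.cast_abs]
    have : (1 : ℤ) ≤ |2 * n - 1| := Int.one_le_abs (by omega)
    have : (1 : ℝ) ≤ ((|2 * n - 1| : ℤ) : ℝ) := by exact_mod_cast this
    nlinarith
  refine ⟨ofLine _ _ hz, ofLine_memH1 H hz, ?_, ?_, ?_⟩
  · refine (ofLine_sum (by norm_num) _).trans ?_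
    rw [lineP_affine 2 (by norm_num) _ hl.ne']
    congr 2
    rw [abs_of_pos (by positivity), abs_of_pos hl, Real.rpow_two, mul_pow, hs]
    field_simp
  · refine (ofLine_sum (by norm_num) _).trans ?_
    rw [lineP_affine 2 (by norm_num) _ hl.ne']
    congr 2
    rw [abs_of_pos (by positivity), abs_of_pos hl, Real.rpow_two, mul_pow, mul_pow, hs]
    field_simp
  · refine (ofLine_sum (by norm_num) _).trans ?_
    rw [lineP_affine 6 (by norm_num) _ hl.ne']
    congr 2
    rw [abs_of_pos (by positivity), abs_of_pos hl, show (6:ℝ) = (6:ℕ) by norm_num,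
      Real.rpow_natCast, mul_pow, show √lam ^ 6 = (√lam ^ 2) ^ 3 by ring, hs]
    field_simp

lemma compact_finite {f : ℝ → ℝ} (hf : Continuous f) {R : ℝ} (hR : ∀ x, R < |x| → f x = 0) {p : ℝ}
    (hp : 0 < p) : lineP p f Set.univ < ⊤ := by
  obtain ⟨M, hM⟩ := (isCompact_Icc (a := -R) (b := R)).exists_bound_of_continuousOn hf.continuousOn
  have e : lineP p f Set.univ = lineP p f (Set.Icc (-R) R) := by
    unfold lineP
    rw [Measure.restrict_univ, ← lintegral_indicator measurableSet_Icc]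
    refine lintegral_congr fun x => ?_
    by_cases hx : x ∈ Set.Icc (-R) R
    · simp [hx]
    · have : R < |x| := by
        by_contra hc
        exact hx (abs_le.1 (not_lt.1 hc))
      simp [hx, hR x this, hp]
  rw [e]
  refine (lineP_le_of hp measurableSet_Icc (fun x hx => hM x hx)).trans_lt ?_
  exact ENNReal.mul_lt_top (ENNReal.rpow_lt_top_of_nonneg hp.le ENNReal.ofReal_ne_top) (by simp)

lemma zero_of_deriv {f g : ℝ → ℝ} (h : LineH1 f g) (hg : lineP 2 g Set.univ = 0) (x : ℝ) :
    f x = 0 := by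
  have key : ∀ a ≤ x, f x = f a := fun a ha => by
    have := prim_cs h.1 ha
    rw [le_antisymm ((lineP_mono (Set.subset_univ _)).trans hg.le) zero_le, mul_zero,
      nonpos_iff_eq_zero, ENNReal.ofReal_eq_zero] at this
    nlinarith [sq_nonneg (f x - f a)]
  by_contra hne
  have hp : 0 < f x ^ 2 := by positivity
  obtain ⟨s, hs, hs2⟩ := exists_small h.2.1 (half_pos hp) x
  rw [← key s hs] at hs2
  linarith

lemma nonzero_of_mass {u : GridFunc} (h : gridLpPow 2 u.h u.w ≠ 0) : u.Nonzero := by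
  by_contra hc
  simp only [GridFunc.Nonzero, not_or, not_exists, not_not] at hc
  apply h
  simp [gridLpPow, hc.1, hc.2]

lemma lineGN_of_lub {K : ℝ} (hK : ∀ q ∈ gnSet 6, q ≤ K) : LineGN K := by
  intro f g h
  by_contra hcon
  obtain ⟨f₂, g₂, R, H, hR, hA⟩ := compact_approx h ENNReal.ofReal_ne_top (not_le.1 hcon)
  obtain ⟨u, hu, e1, e2, e3⟩ := scale_embed H hR one_pos (lam := 2 * |R| + 1) (by positivity)
    (by linarith [le_abs_self R])
  have hAt := (compact_finite H.1.1 hR (p := 6) (by norm_num)).ne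
  have hA0 : lineP 6 f₂ Set.univ ≠ 0 := (zero_le.trans_lt hA).ne'
  have hex : ¬ ∀ x, f₂ x = 0 := fun hz =>
    hA0 (lineP_eq_zero_of (by norm_num) MeasurableSet.univ fun x _ => hz x)
  have hB0 : lineP 2 f₂ Set.univ ≠ 0 := fun hz =>
    hex fun x => zero_of_lineP (by norm_num) H.1.1 isOpen_univ hz x trivial
  have hC0 : lineP 2 g₂ Set.univ ≠ 0 := fun hz => hex fun x => zero_of_deriv H hz x
  have hq := hK _ ⟨u, hu, nonzero_of_mass (by rw [e1]; simpa using hB0), rfl⟩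
  have b0 := ENNReal.toReal_pos hB0 H.2.1.ne
  have c0 := ENNReal.toReal_pos hC0 H.2.2.ne
  have a0 := ENNReal.toReal_pos hA0 hAt
  have l0 : (0:ℝ) < 2 * |R| + 1 := by positivity
  rw [GridFunc.gnQuot, e1, e2, e3] at hq
  simp only [ENNReal.toReal_mul] at hq
  rw [ENNReal.toReal_ofReal (by positivity), ENNReal.toReal_ofReal (by positivity),
    ENNReal.toReal_ofReal (by positivity), show ((6:ℝ) - 2) / 2 = (2:ℕ) by norm_num,
    Real.rpow_natCast, div_le_iff₀ (by positivity)] at hq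
  have hq2 : (lineP 6 f₂ Set.univ).toReal ≤
      K * (lineP 2 f₂ Set.univ).toReal ^ 2 * (lineP 2 g₂ Set.univ).toReal := by
    have hl2 : 0 < (2 * |R| + 1) ^ 2 := by positivity
    refine le_of_mul_le_mul_left ?_ hl2
    linarith
  have hK0 : 0 ≤ K := by
    by_contra hneg
    have : K * (lineP 2 f₂ Set.univ).toReal ^ 2 * (lineP 2 g₂ Set.univ).toReal < 0 :=
      mul_neg_of_neg_of_pos (mul_neg_of_neg_of_pos (not_le.1 hneg) (by positivity)) c0
    linarith
  have hA' := (ENNReal.toReal_lt_toReal hA.ne_top hAt).2 hA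
  simp only [ENNReal.toReal_mul, ENNReal.toReal_pow, ENNReal.toReal_ofReal hK0] at hA'
  linarith

lemma exists_bump : ∃ T T' : ℝ → ℝ, LineH1 T T' ∧ (∀ x, 2 < |x| → T x = 0) ∧ T 0 = 1 := by
  let b : ContDiffBump (0:ℝ) := ⟨1, 2, one_pos, one_lt_two⟩
  have hz : ∀ x, 2 < |x| → b x = 0 := fun x hx => b.zero_of_le_dist (by simpa [b] using hx.le)
  have hd : ContDiff ℝ 1 b := b.contDiff
  have hc : Continuous (deriv b) := hd.continuous_deriv le_rfl
  have hz' : ∀ x, 2 < |x| → deriv b x = 0 := fun x hx => by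
    have : b =ᶠ[𝓝 x] fun _ => 0 := by
      have ho : IsOpen {x : ℝ | 2 < |x|} := isOpen_lt continuous_const continuous_abs
      filter_upwards [ho.mem_nhds hx] with y hy using hz y hy
    rw [this.deriv_eq]; simp
  refine ⟨b, deriv b, ⟨⟨b.continuous, hc.locallyIntegrable, fun x y => ?_⟩,
    compact_finite b.continuous hz (by norm_num), compact_finite hc hz' (by norm_num)⟩, hz, ?_⟩
  · exact intervalIntegral.integral_deriv_eq_sub
      (fun t _ => (hd.differentiable (by norm_num)).differentiableAt) (hc.intervalIntegrable _ _)
  · exact b.one_of_mem_closedBall (by simp [b])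

lemma lineGN_pos {K : ℝ} (hL : LineGN K) : 0 < K := by
  obtain ⟨T, T', H, hz, h1⟩ := exists_bump
  by_contra hneg
  have := hL T T' H
  rw [ENNReal.ofReal_eq_zero.2 (not_lt.1 hneg), zero_mul, zero_mul, nonpos_iff_eq_zero] at this
  have := zero_of_lineP (by norm_num) H.1.1 isOpen_univ this 0 trivial
  rw [h1] at this; norm_num at this

lemma exists_spread {μ δ : ℝ} (hμ : 0 < μ) (hδ : 0 < δ) :
    ∃ u : GridFunc, u.MemH1 ∧ u.mass = μ ∧ (gridLpPow 2 u.hd u.wd).toReal ≤ δ := by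
  obtain ⟨T, T', H, hz, h1⟩ := exists_bump
  have hB0 : lineP 2 T Set.univ ≠ 0 := fun h0 => by
    have := zero_of_lineP (by norm_num) H.1.1 isOpen_univ h0 0 trivial
    rw [h1] at this; norm_num at this
  have b0 := ENNReal.toReal_pos hB0 H.2.1.ne
  set b := (lineP 2 T Set.univ).toReal with hb
  set c := (lineP 2 T' Set.univ).toReal with hc
  have c0 : 0 ≤ c := ENNReal.toReal_nonneg
  obtain ⟨ε, hε, hεδ⟩ : ∃ ε : ℝ, 0 < ε ∧ μ * ε ^ 2 * c / b ≤ δ := by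
    have hp : 0 < μ * c / b + 1 := by positivity
    refine ⟨min 1 (δ / (μ * c / b + 1)), by positivity, ?_⟩
    set ε := min 1 (δ / (μ * c / b + 1)) with hεdef
    have h0 : 0 < ε := by positivity
    have i1 : ε ≤ 1 := min_le_left _ _
    have i2 : ε * (μ * c / b + 1) ≤ δ := by
      rw [← le_div_iff₀ hp]; exact min_le_right _ _
    have i3 : 0 ≤ μ * c / b := by positivity
    calc μ * ε ^ 2 * c / b = ε ^ 2 * (μ * c / b) := by ring
      _ ≤ ε * (μ * c / b) := by gcongr; nlinarith
      _ ≤ δ := by nlinarith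
  set S : ℝ≥0∞ := ∑' j : ℤ, ENNReal.ofReal (T (ε * j) ^ 2) with hS
  have hSt : S ≠ ⊤ := by
    rw [hS, tsum_eq_sum (s := Finset.Icc (-⌈2 / ε⌉) ⌈2 / ε⌉)]
    · exact ENNReal.sum_ne_top.2 fun _ _ => ENNReal.ofReal_ne_top
    · intro j hj
      rw [hz]; · simp
      by_contra hcon
      apply hj
      rw [abs_mul, abs_of_pos hε, not_lt, mul_comm, ← le_div_iff₀ hε] at hcon
      rw [Finset.mem_Icc, ← abs_le]
      have := hcon.trans (Int.le_ceil (2 / ε))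
      rw [← Int.cast_abs] at this
      exact_mod_cast this
  have hS0 : S ≠ 0 := by
    intro h0
    have := ENNReal.tsum_eq_zero.1 h0 0
    simp [h1] at this
  have s0 := ENNReal.toReal_pos hS0 hSt
  set s := S.toReal with hs
  set a := √(μ * ε / (2 * s * b)) with ha
  have ha2 : a ^ 2 = μ * ε / (2 * s * b) := Real.sq_sqrt (by positivity)
  let u : GridFunc :=
    { h := fun j x => (a * T (ε * j)) * T (ε * x + 0)
      w := fun j x => (a * T (ε * j)) * T (ε * x + 0)
      hd := fun j x => (a * T (ε * j)) * ε * T' (ε * x + 0)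
      wd := fun j x => (a * T (ε * j)) * ε * T' (ε * x + 0)
      compat := fun j k => by simp only [add_zero]; ring }
  have HL : ∀ j : ℤ, LineH1 (fun x => (a * T (ε * j)) * T (ε * x + 0))
      (fun x => (a * T (ε * j)) * ε * T' (ε * x + 0)) := fun j => H.affine hε.ne' _ _
  have em : gridLpPow 2 u.h u.w = 2 * (S * (ENNReal.ofReal (a ^ 2 * ε⁻¹) * lineP 2 T Set.univ)) := by
    have : ∀ j : ℤ, ∫⁻ x : ℝ, (‖(a * T (ε * j)) * T (ε * x + 0)‖₊ : ℝ≥0∞) ^ (2:ℝ) =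
        ENNReal.ofReal (T (ε * j) ^ 2) * (ENNReal.ofReal (a ^ 2 * ε⁻¹) * lineP 2 T Set.univ) := by
      intro j
      have := lineP_affine 2 (by norm_num) T hε.ne' (a * T (ε * j)) 0
      rw [lineP, Measure.restrict_univ] at this
      rw [this, ← mul_assoc, ← ENNReal.ofReal_mul (by positivity)]
      congr 2
      rw [Real.rpow_two, sq_abs, abs_of_pos hε]; ring
    simp only [gridLpPow, u, this, ENNReal.tsum_mul_right]
    rw [← hS, two_mul]
  have ed : gridLpPow 2 u.hd u.wd = 2 * (S * (ENNReal.ofReal (a ^ 2 * ε) * lineP 2 T' Set.univ)) := by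
    have : ∀ j : ℤ, ∫⁻ x : ℝ, (‖(a * T (ε * j)) * ε * T' (ε * x + 0)‖₊ : ℝ≥0∞) ^ (2:ℝ) =
        ENNReal.ofReal (T (ε * j) ^ 2) * (ENNReal.ofReal (a ^ 2 * ε) * lineP 2 T' Set.univ) := by
      intro j
      have := lineP_affine 2 (by norm_num) T' hε.ne' (a * T (ε * j) * ε) 0
      rw [lineP, Measure.restrict_univ] at this
      rw [this, ← mul_assoc, ← ENNReal.ofReal_mul (by positivity)]
      congr 2
      rw [Real.rpow_two, sq_abs, abs_of_pos hε]; field_simp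
    simp only [gridLpPow, u, this, ENNReal.tsum_mul_right]
    rw [← hS, two_mul]
  have hBt := H.2.1.ne
  have hCt := H.2.2.ne
  refine ⟨u, ⟨fun j => (HL j).1.1, fun j => (HL j).1.1, fun j => (HL j).1.2.1,
    fun j => (HL j).1.2.1, fun j => (HL j).1.2.2 0, fun j => (HL j).1.2.2 0, ?_, ?_⟩, ?_, ?_⟩
  · rw [em]; exact ENNReal.mul_lt_top (by simp) (ENNReal.mul_lt_top hSt.lt_top
      (ENNReal.mul_lt_top (by simp) hBt.lt_top))
  · rw [ed]; exact ENNReal.mul_lt_top (by simp) (ENNReal.mul_lt_top hSt.lt_top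
      (ENNReal.mul_lt_top (by simp) hCt.lt_top))
  · rw [GridFunc.mass, em]
    simp only [ENNReal.toReal_mul]
    rw [ENNReal.toReal_ofReal (by positivity), ← hs, ← hb, ha2]
    simp; field_simp
  · rw [ed]
    simp only [ENNReal.toReal_mul]
    rw [ENNReal.toReal_ofReal (by positivity), ← hs, ← hc, ha2]
    refine le_trans (le_of_eq ?_) hεδ
    simp; field_simp

lemma unbounded_below {K μ : ℝ} (hK : IsLUB (gnSet 6) K) (hμ : 0 < μ) (hc : 3 / μ ^ 2 < K) (c : ℝ) :
    ∃ u : GridFunc, u.MemH1 ∧ u.mass = μ ∧ u.energy 6 < c := by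
  have hq0 : 0 < 3 / μ ^ 2 := by positivity
  have hnot : ¬ LineGN (3 / μ ^ 2) := by
    intro hL
    refine absurd (hK.2 ?_) (not_le.2 hc)
    rintro _ ⟨u, hu, -, rfl⟩
    rw [GridFunc.gnQuot]
    have := grid_gn_real hq0.le hL hu
    rw [show ((6:ℝ) - 2) / 2 = (2:ℕ) by norm_num, Real.rpow_natCast]
    exact div_le_of_le_mul₀ (by positivity) hq0.le (by linarith)
  simp only [LineGN, not_forall, not_le] at hnot
  obtain ⟨f, g, h, hA⟩ := hnot
  obtain ⟨f₂, g₂, R, H, hR, hA⟩ := compact_approx h ENNReal.ofReal_ne_top hA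
  have hAt := (compact_finite H.1.1 hR (p := 6) (by norm_num)).ne
  have hA0 : lineP 6 f₂ Set.univ ≠ 0 := (zero_le.trans_lt hA).ne'
  have hB0 : lineP 2 f₂ Set.univ ≠ 0 := fun hz =>
    hA0 (lineP_eq_zero_of (by norm_num) MeasurableSet.univ fun x _ =>
      zero_of_lineP (by norm_num) H.1.1 isOpen_univ hz x trivial)
  have b0 := ENNReal.toReal_pos hB0 H.2.1.ne
  have hA' := (ENNReal.toReal_lt_toReal hA.ne_top hAt).2 hA
  simp only [ENNReal.toReal_mul, ENNReal.toReal_pow, ENNReal.toReal_ofReal hq0.le] at hA'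
  set A := (lineP 6 f₂ Set.univ).toReal with hAd
  set B := (lineP 2 f₂ Set.univ).toReal with hBd
  set C := (lineP 2 g₂ Set.univ).toReal with hCd
  set α := √(μ / B) with hα
  have hα0 : 0 < α := by positivity
  have hα2 : α ^ 2 = μ / B := Real.sq_sqrt (by positivity)
  set D := α ^ 6 * A / 6 - α ^ 2 * C / 2 with hD
  have hD0 : 0 < D := by
    have e : α ^ 6 = (μ / B) ^ 3 := by rw [← hα2]; ring
    rw [hD, e, hα2]
    have : (μ / B) ^ 3 * (3 / μ ^ 2 * B ^ 2 * C) / 6 < (μ / B) ^ 3 * A / 6 := by gcongr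
    have e2 : (μ / B) ^ 3 * (3 / μ ^ 2 * B ^ 2 * C) / 6 = μ / B * C / 2 := by field_simp; ring
    linarith
  set lam := 2 * |R| + 1 + (|c| / D + 1) with hlam
  have hl1 : 1 ≤ lam := by
    have : 0 ≤ |c| / D := by positivity
    linarith [abs_nonneg R]
  obtain ⟨u, hu, e1, e2, e3⟩ := scale_embed H hR hα0 (lam := lam) (by linarith) (by
    have : 0 ≤ |c| / D := by positivity
    linarith [le_abs_self R, abs_nonneg R])
  refine ⟨u, hu, ?_, ?_⟩
  · rw [GridFunc.mass, e1, ENNReal.toReal_mul, ENNReal.toReal_ofReal (by positivity), ← hBd, hα2]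
    field_simp
  · rw [GridFunc.energy, e2, e3, ENNReal.toReal_mul, ENNReal.toReal_mul,
      ENNReal.toReal_ofReal (by positivity), ENNReal.toReal_ofReal (by positivity), ← hAd, ← hCd]
    have e : 1 / 2 * (α ^ 2 * lam ^ 2 * C) - 1 / 6 * (α ^ 6 * lam ^ 2 * A) = - (lam ^ 2 * D) := by
      rw [hD]; ring
    rw [e]
    have h1 : |c| < lam * D := by
      rw [← div_lt_iff₀ hD0]; linarith [abs_nonneg R]
    have h2 : lam * D ≤ lam ^ 2 * D := by gcongr; nlinarith
    linarith [neg_abs_le c]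

lemma no_grid_equality {K : ℝ} (hK : 0 < K) (hL : LineGN K) {u : GridFunc} (hu : u.MemH1)
    (hB0 : gridLpPow 2 u.h u.w ≠ 0)
    (hA : gridLpPow 6 u.h u.w =
      ENNReal.ofReal K * gridLpPow 2 u.h u.w ^ 2 * gridLpPow 2 u.hd u.wd) : False := by
  have hBt := hu.2.2.2.2.2.2.1.ne
  have hCt := hu.2.2.2.2.2.2.2.ne
  have hAt : gridLpPow 6 u.h u.w ≠ ⊤ := by
    rw [hA]
    exact ENNReal.mul_ne_top (ENNReal.mul_ne_top ENNReal.ofReal_ne_top (ENNReal.pow_ne_top hBt)) hCt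
  set B := gridLpPow 2 u.h u.w with hB
  have eB : B = ∑' i, lineP 2 (u.line i) Set.univ := grid_sum _ _ _
  have eC : gridLpPow 2 u.hd u.wd = ∑' i, lineP 2 (u.dline i) Set.univ := grid_sum _ _ _
  have eA : gridLpPow 6 u.h u.w = ∑' i, lineP 6 (u.line i) Set.univ := grid_sum _ _ _
  have hBi : ∀ i, lineP 2 (u.line i) Set.univ ≤ B := fun i => by rw [eB]; exact ENNReal.le_tsum i
  have hH := memH1_line hu
  have l1 := fun i => hL _ _ (hH i)
  have l2 : ∀ i, ENNReal.ofReal K * lineP 2 (u.line i) Set.univ ^ 2 * lineP 2 (u.dline i) Set.univ ≤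
      ENNReal.ofReal K * B ^ 2 * lineP 2 (u.dline i) Set.univ := fun i => by
    gcongr; exact hBi i
  have leq : ∀ i, lineP 6 (u.line i) Set.univ =
      ENNReal.ofReal K * B ^ 2 * lineP 2 (u.dline i) Set.univ := by
    intro i
    refine le_antisymm ((l1 i).trans (l2 i)) (not_lt.1 fun hlt => ?_)
    have := ENNReal.tsum_lt_tsum (by rw [← eA]; exact hAt) (fun i => (l1 i).trans (l2 i)) hlt
    rw [ENNReal.tsum_mul_left, ← eA, ← eC, hA] at this
    exact lt_irrefl _ this
  obtain ⟨i, hi⟩ : ∃ i, lineP 2 (u.dline i) Set.univ ≠ 0 := by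
    by_contra! hcon
    apply hB0
    rw [eB, ENNReal.tsum_eq_zero]
    exact fun i => lineP_eq_zero_of (by norm_num) MeasurableSet.univ
      fun x _ => zero_of_deriv (hH i) (hcon i) x
  have hCi := (hH i).2.2.ne
  have hKe : ENNReal.ofReal K ≠ 0 := by simpa using hK
  have e1 : ENNReal.ofReal K * lineP 2 (u.line i) Set.univ ^ 2 * lineP 2 (u.dline i) Set.univ =
      ENNReal.ofReal K * B ^ 2 * lineP 2 (u.dline i) Set.univ :=
    le_antisymm (l2 i) ((leq i).symm.trans_le (l1 i))
  have e2 : lineP 2 (u.line i) Set.univ = B := by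
    have h3 := (ENNReal.mul_left_inj hi hCi).1 e1
    have h4 := (ENNReal.mul_right_inj hKe ENNReal.ofReal_ne_top).1 h3
    exact (ENNReal.pow_right_strictMono two_ne_zero).injective h4
  have hother : ∀ j, j ≠ i → ∀ x, u.line j x = 0 := by
    intro j hj x
    have h1 : lineP 2 (u.line j) Set.univ + lineP 2 (u.line i) Set.univ ≤ B := by
      have := ENNReal.sum_le_tsum (f := fun i => lineP 2 (u.line i) Set.univ) {j, i}
      rwa [Finset.sum_pair hj, ← eB] at this
    rw [e2] at h1
    have h2 : lineP 2 (u.line j) Set.univ = 0 := by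
      have : lineP 2 (u.line j) Set.univ + B ≤ 0 + B := by simpa using h1
      exact nonpos_iff_eq_zero.1 ((ENNReal.add_le_add_iff_right hBt).1 this)
    exact zero_of_lineP (by norm_num) (hH j).1.1 isOpen_univ h2 x trivial
  refine no_equality hK hL (hH i) ?_ ?_ ((leq i).trans (by rw [e2]))
  · intro n
    rcases i with j | k
    · have := hother (Sum.inr n) (by simp) j
      simp only [GridFunc.line, Sum.elim_inl, Sum.elim_inr] at this ⊢
      rw [u.compat]; exact this
    · have := hother (Sum.inl n) (by simp) k
      simp only [GridFunc.line, Sum.elim_inl, Sum.elim_inr] at this ⊢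
      rw [← u.compat]; exact this
  · by_contra! hcon
    exact hB0 (e2 ▸ lineP_eq_zero_of (by norm_num) MeasurableSet.univ fun x _ => hcon x)

lemma critMass_six (K : ℝ) : critMass 6 K = √(3 / K) := by
  rw [critMass, Real.sqrt_eq_rpow]
  congr 1
  · rw [show (6:ℝ) = 2 * 3 by norm_num, mul_div_mul_left _ _ (by norm_num)]
  · norm_num

/-- **Dimensional crossover, part (iii) (Theorem 1.2(iii))**: for `p = 6`,
with `K_6` the optimal Gagliardo–Nirenberg constant and
`μ_6 = (6/(2K_6))^{2/(6−2)}` the critical mass: no ground state of mass `μ`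
exists for any `μ > 0`; moreover if `μ ≤ μ_6` then `E_6 ≥ 0` on `H¹_μ(𝒢)`
(so `ℰ_6(μ) = 0`, and it is not attained), while if `μ > μ_6` then `E_6` is
unbounded from below on `H¹_μ(𝒢)` (i.e. `ℰ_6(μ) = −∞`). -/
theorem grid_crossover_iii (K μ : ℝ) (hK : IsLUB (gnSet 6) K) (hμ : 0 < μ) :
    (¬ ∃ u : GridFunc, IsGroundState 6 μ u) ∧
    (μ ≤ critMass 6 K →
      (∀ u : GridFunc, u.MemH1 → u.mass = μ → 0 ≤ u.energy 6) ∧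
      IsGLB (energySet 6 μ) 0) ∧
    (critMass 6 K < μ →
      ∀ c : ℝ, ∃ u : GridFunc, u.MemH1 ∧ u.mass = μ ∧ u.energy 6 < c) := by
  have hL : LineGN K := lineGN_of_lub fun q hq => hK.1 hq
  have hK0 := lineGN_pos hL
  have hge : μ ≤ critMass 6 K → ∀ u : GridFunc, u.MemH1 → u.mass = μ → 0 ≤ u.energy 6 ∧
      (u.energy 6 ≤ 0 → False) := by
    intro hle u hu hm
    rw [critMass_six, Real.le_sqrt hμ.le (by positivity), le_div_iff₀ hK0] at hle
    have h1 := grid_gn_real hK0.le hL hu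
    rw [GridFunc.mass] at hm
    have c0 : 0 ≤ (gridLpPow 2 u.hd u.wd).toReal := ENNReal.toReal_nonneg
    have h2 : K * (gridLpPow 2 u.h u.w).toReal ^ 2 * (gridLpPow 2 u.hd u.wd).toReal ≤
        3 * (gridLpPow 2 u.hd u.wd).toReal := by
      rw [hm]; gcongr; linarith
    refine ⟨by rw [GridFunc.energy]; linarith, fun he => ?_⟩
    rw [GridFunc.energy] at he
    have h3 : (gridLpPow 6 u.h u.w).toReal =
        K * (gridLpPow 2 u.h u.w).toReal ^ 2 * (gridLpPow 2 u.hd u.wd).toReal := by linarith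
    have hBt := hu.2.2.2.2.2.2.1.ne
    have hCt := hu.2.2.2.2.2.2.2.ne
    have hRt : ENNReal.ofReal K * gridLpPow 2 u.h u.w ^ 2 * gridLpPow 2 u.hd u.wd ≠ ⊤ :=
      ENNReal.mul_ne_top (ENNReal.mul_ne_top ENNReal.ofReal_ne_top (ENNReal.pow_ne_top hBt)) hCt
    have hAt := ((grid_gn hL hu).trans_lt hRt.lt_top).ne
    refine no_grid_equality hK0 hL hu (fun hz => ?_) ((ENNReal.toReal_eq_toReal_iff' hAt hRt).1 ?_)
    · rw [hz] at hm; simp at hm; linarith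
    · rw [h3, ENNReal.toReal_mul, ENNReal.toReal_mul, ENNReal.toReal_pow,
        ENNReal.toReal_ofReal hK0.le]
  have hsmall : ∀ δ > 0, ∃ u : GridFunc, u.MemH1 ∧ u.mass = μ ∧ u.energy 6 ≤ δ := by
    intro δ hδ
    obtain ⟨u, hu, hm, hd⟩ := exists_spread hμ hδ
    refine ⟨u, hu, hm, ?_⟩
    rw [GridFunc.energy]
    have : 0 ≤ (gridLpPow 6 u.h u.w).toReal := ENNReal.toReal_nonneg
    linarith
  have hunb : critMass 6 K < μ →
      ∀ c : ℝ, ∃ u : GridFunc, u.MemH1 ∧ u.mass = μ ∧ u.energy 6 < c := by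
    intro hlt c
    refine unbounded_below hK hμ ?_ c
    rw [critMass_six, Real.sqrt_lt' hμ, div_lt_iff₀ hK0] at hlt
    rw [div_lt_iff₀ (by positivity)]
    linarith
  refine ⟨?_, fun hle => ⟨fun u hu hm => (hge hle u hu hm).1, ?_, ?_⟩, hunb⟩
  · rintro ⟨u, hu, hm, hmin⟩
    rcases le_or_gt μ (critMass 6 K) with hle | hlt
    · refine (hge hle u hu hm).2 (le_of_forall_pos_le_add fun δ hδ => ?_)
      obtain ⟨v, hv, hvm, hve⟩ := hsmall δ hδ
      have := hmin v hv hvm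
      linarith
    · obtain ⟨v, hv, hvm, hve⟩ := hunb hlt (u.energy 6)
      exact absurd (hmin v hv hvm) (not_le.2 hve)
  · rintro _ ⟨u, hu, hm, rfl⟩
    exact (hge hle u hu hm).1
  · intro x hx
    refine le_of_forall_pos_le_add fun δ hδ => ?_
    obtain ⟨v, hv, hvm, hve⟩ := hsmall δ hδ
    have := hx ⟨v, hv, hvm, rfl⟩
    linarith

end
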